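/- arXiv:1004.0434 — 6 statements merged into one kernel-verified Lean document; each statement's English description precedes it below -/
import Mathlib

section
/- Let ρ be the 4×4 X-state determined by 2×2 matrices a = [[a₁₁, a₁₂],[conj(a₁₂), a₂₂]] and b = [[b₁₁, b₁₂],[conj(b₁₂), b₂₂]], with a₁₁, a₂₂, b₁₁, b₂₂ real, a₁₂ ≠ 0, b₁₂ ≠ 0, and assume ρ is positive semidefinite. Then ρ is classical-quantum — i.e. there exist an orthonormal basis {f₁, f₂} of ℂ² and positive semidefinite 2×2 matrices σ₁, σ₂ with ρ = |f₁⟩⟨f₁| ⊗ σ₁ + |f₂⟩⟨f₂| ⊗ σ₂ — if and only if |a₁₂| = |b₁₂|, a₁₁ = b₂₂, and a₂₂ = b₁₁. -/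
open Matrix ComplexOrder

/-- The two-qubit X-state determined by the `2 × 2` matrices `a` and `b`. -/
noncomputable def Xstate (a b : Matrix (Fin 2) (Fin 2) ℂ) :
    Matrix (Fin 2 ⊕ Fin 2) (Fin 2 ⊕ Fin 2) ℂ :=
  fromBlocks !![a 0 0, 0; 0, b 0 0] !![0, a 0 1; b 0 1, 0]
             !![0, b 1 0; a 1 0, 0] !![b 1 1, 0; 0, a 1 1]

/-- The rank-one projector `|f⟩⟨f|` onto a vector `f ∈ ℂ²`. -/
noncomputable def proj2 (f : Fin 2 → ℂ) : Matrix (Fin 2) (Fin 2) ℂ :=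
  vecMulVec f (star f)

/-- Kronecker product of a `2 × 2` matrix with a `2 × 2` matrix, as a block matrix. -/
noncomputable def kron2 (A B : Matrix (Fin 2) (Fin 2) ℂ) :
    Matrix (Fin 2 ⊕ Fin 2) (Fin 2 ⊕ Fin 2) ℂ :=
  fromBlocks (A 0 0 • B) (A 0 1 • B) (A 1 0 • B) (A 1 1 • B)

/-- A two-qubit state is classical–quantum (zero quantum discord `D_A(ρ) = 0`) if
`ρ = |f₁⟩⟨f₁| ⊗ σ₁ + |f₂⟩⟨f₂| ⊗ σ₂` for an orthonormal basis `{f₁, f₂}` of `ℂ²`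
and positive semidefinite `σ₁, σ₂`. -/
def IsCQ (ρ : Matrix (Fin 2 ⊕ Fin 2) (Fin 2 ⊕ Fin 2) ℂ) : Prop :=
  ∃ (f₁ f₂ : Fin 2 → ℂ) (σ₁ σ₂ : Matrix (Fin 2) (Fin 2) ℂ),
    star f₁ ⬝ᵥ f₁ = 1 ∧ star f₂ ⬝ᵥ f₂ = 1 ∧ star f₁ ⬝ᵥ f₂ = 0 ∧
    σ₁.PosSemidef ∧ σ₂.PosSemidef ∧
    ρ = kron2 (proj2 f₁) σ₁ + kron2 (proj2 f₂) σ₂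

/-- A positive semidefinite Hermitian X-state with `a₁₂ ≠ 0` and `b₁₂ ≠ 0` is
classical–quantum iff `|a₁₂| = |b₁₂|`, `a₁₁ = b₂₂` and `a₂₂ = b₁₁`. -/
theorem xstate_isCQ_iff (a₁₁ a₂₂ b₁₁ b₂₂ : ℝ) (a₁₂ b₁₂ : ℂ)
    (ha : a₁₂ ≠ 0) (hb : b₁₂ ≠ 0)
    (hρ : (Xstate !![(a₁₁ : ℂ), a₁₂; (starRingEnd ℂ) a₁₂, (a₂₂ : ℂ)]
                  !![(b₁₁ : ℂ), b₁₂; (starRingEnd ℂ) b₁₂, (b₂₂ : ℂ)]).PosSemidef) :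
    IsCQ (Xstate !![(a₁₁ : ℂ), a₁₂; (starRingEnd ℂ) a₁₂, (a₂₂ : ℂ)]
                 !![(b₁₁ : ℂ), b₁₂; (starRingEnd ℂ) b₁₂, (b₂₂ : ℂ)]) ↔
      (‖a₁₂‖ = ‖b₁₂‖ ∧ a₁₁ = b₂₂ ∧ a₂₂ = b₁₁) := by
  constructor
  · rintro ⟨f, g, S, T, hf, hg, hfg, -, -, h⟩
    have e := fun i j => congrFun (congrFun h i) j
    have h1 := e (.inl 0) (.inr 1)
    have h2 := e (.inl 1) (.inr 0)
    have h3 := e (.inr 0) (.inl 1)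
    have h4 := e (.inr 1) (.inl 0)
    have h5 := e (.inl 0) (.inl 0)
    have h6 := e (.inl 1) (.inl 1)
    have h7 := e (.inr 0) (.inr 0)
    have h8 := e (.inr 1) (.inr 1)
    have h9 := e (.inl 0) (.inl 1)
    have h10 := e (.inr 0) (.inr 1)
    clear e h hρ
    simp [Xstate, kron2, proj2, vecMulVec_apply] at h1 h2 h3 h4 h5 h6 h7 h8 h9 h10
    simp [dotProduct, Fin.sum_univ_two] at hf hg hfg
    have hgf : (starRingEnd ℂ) (g 0) * f 0 + (starRingEnd ℂ) (g 1) * f 1 = 0 := by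
      have := congrArg (starRingEnd ℂ) hfg
      simp at this
      linear_combination this
    -- completeness relations
    have hU : !![(starRingEnd ℂ) (f 0), (starRingEnd ℂ) (f 1);
        (starRingEnd ℂ) (g 0), (starRingEnd ℂ) (g 1)] * !![f 0, g 0; f 1, g 1] = 1 := by
      rw [Matrix.mul_fin_two, hf, hg, hfg, hgf, Matrix.one_fin_two]
    have hU' := mul_eq_one_comm.mp hU
    rw [Matrix.mul_fin_two, Matrix.one_fin_two] at hU'
    have c00 := congrFun (congrFun hU' 0) 0
    have c01 := congrFun (congrFun hU' 0) 1
    have c10 := congrFun (congrFun hU' 1) 0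
    have c11 := congrFun (congrFun hU' 1) 1
    simp at c00 c01 c10 c11
    clear hU hU'
    generalize hq : f 0 * (starRingEnd ℂ) (f 1) = q at *
    have hq' : f 1 * (starRingEnd ℂ) (f 0) = (starRingEnd ℂ) q := by
      rw [← hq]; simp [mul_comm]
    rw [hq'] at h3 h4 c10
    generalize hp : f 0 * (starRingEnd ℂ) (f 0) = p at *
    have hp' : f 1 * (starRingEnd ℂ) (f 1) = 1 - p := by
      rw [← hp]; linear_combination hf
    have g00 : g 0 * (starRingEnd ℂ) (g 0) = 1 - p := by linear_combination c00
    have g01 : g 0 * (starRingEnd ℂ) (g 1) = - q := by linear_combination c01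
    have g10 : g 1 * (starRingEnd ℂ) (g 0) = - (starRingEnd ℂ) q := by linear_combination c10
    have g11 : g 1 * (starRingEnd ℂ) (g 1) = p := by linear_combination c11 - hp'
    rw [g01] at h1 h2
    rw [g10] at h3 h4
    rw [g00] at h5 h6 h9
    rw [hp', g11] at h7 h8 h10
    have hq0 : q ≠ 0 := by
      rintro rfl
      apply ha
      rw [h1]; ring
    have hD : S 0 1 - T 0 1 ≠ 0 := by
      intro h0
      apply ha
      rw [h1]; linear_combination q * h0
    have hpp : 2 * p - 1 = 0 := by
      have : (2 * p - 1) * (S 0 1 - T 0 1) = 0 := by linear_combination h10 - h9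
      exact (mul_eq_zero.mp this).resolve_right hD
    refine ⟨?_, ?_, ?_⟩
    · have k : (starRingEnd ℂ) b₁₂ * q = (starRingEnd ℂ) q * a₁₂ := by
        rw [h3, h1]; ring
      have := congrArg norm k
      simp only [norm_mul, RCLike.norm_conj] at this
      have hn : ‖q‖ ≠ 0 := norm_ne_zero_iff.mpr hq0
      apply mul_left_cancel₀ hn
      linarith
    · have : (a₁₁ : ℂ) = b₂₂ := by
        rw [h5, h7]; linear_combination (S 0 0 - T 0 0) * hpp
      exact_mod_cast this
    · have : (a₂₂ : ℂ) = b₁₁ := by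
        rw [h6, h8]; linear_combination -(S 1 1 - T 1 1) * hpp
      exact_mod_cast this
  · rintro ⟨hn, rfl, rfl⟩
    obtain ⟨u, hu⟩ := IsAlgClosed.exists_pow_nat_eq (a₁₂ / (starRingEnd ℂ) b₁₂) (n := 2) (by norm_num)
    have hb' : (starRingEnd ℂ) b₁₂ ≠ 0 := by simpa using hb
    have hu2 : u * u * (starRingEnd ℂ) b₁₂ = a₁₂ := by
      rw [← pow_two, hu]; field_simp
    have hun : ‖u‖ = 1 := by
      have := congrArg norm hu
      rw [norm_pow, norm_div, RCLike.norm_conj, hn, div_self (by simpa using hb)] at this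
      exact (pow_eq_one_iff_of_nonneg (norm_nonneg _) (by norm_num)).mp this
    have huu : u * (starRingEnd ℂ) u = 1 := by
      rw [Complex.mul_conj, Complex.normSq_eq_norm_sq, hun]; simp
    have hu3 : (starRingEnd ℂ) u * (starRingEnd ℂ) u * b₁₂ = (starRingEnd ℂ) a₁₂ := by
      rw [← hu2]; simp
    obtain ⟨s, hs, hss⟩ : ∃ s : ℂ, (starRingEnd ℂ) s = s ∧ s * s = 1 / 2 := by
      refine ⟨((√(1/2) : ℝ) : ℂ), Complex.conj_ofReal _, ?_⟩
      rw [← Complex.ofReal_mul, Real.mul_self_sqrt (by norm_num)]; simp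
    have key : ∀ v : ℂ, v * (starRingEnd ℂ) v = 1 →
        v * v * (starRingEnd ℂ) b₁₂ = a₁₂ → (starRingEnd ℂ) v * (starRingEnd ℂ) v * b₁₂ = (starRingEnd ℂ) a₁₂ →
        (!![(a₁₁ : ℂ), (starRingEnd ℂ) v * a₁₂; (starRingEnd ℂ) v * b₁₂, (a₂₂ : ℂ)]).PosSemidef := by
      intro v hv hv2 hv3
      have := hρ.conjTranspose_mul_mul_same
        (fromRows !![s, 0; 0, s] !![s * (starRingEnd ℂ) v, 0; 0, s * (starRingEnd ℂ) v])
      convert this using 1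
      ext i j
      fin_cases i <;> fin_cases j <;>
        simp [Xstate, Matrix.mul_apply, Fin.sum_univ_two, hs]
      · linear_combination (-2 * (a₁₁ : ℂ)) * hss - s * s * a₁₁ * hv
      · rw [← hv2]
        linear_combination (-2 * v * (starRingEnd ℂ) b₁₂) * hss + (1 - s * s) * v * (starRingEnd ℂ) b₁₂ * hv
      · rw [← hv3]
        linear_combination (-2 * (starRingEnd ℂ) v * b₁₂) * hss - s * s * (starRingEnd ℂ) v * b₁₂ * hv
      · linear_combination (-2 * (a₂₂ : ℂ)) * hss - s * s * a₂₂ * hv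
    refine ⟨![s, s * (starRingEnd ℂ) u], ![s, s * (starRingEnd ℂ) (-u)], _, _, ?_, ?_, ?_,
      key u huu hu2 hu3, key (-u) (by simpa using huu) (by simpa using hu2) (by simpa using hu3), ?_⟩
    · simp [dotProduct, Fin.sum_univ_two, hs]
      linear_combination 2 * hss + s * s * huu
    · simp [dotProduct, Fin.sum_univ_two, hs]
      linear_combination 2 * hss + s * s * huu
    · simp [dotProduct, Fin.sum_univ_two, hs]
      linear_combination - s * s * huu
    · ext i j
      rcases i with i | i <;> rcases j with j | j <;> fin_cases i <;> fin_cases j <;>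
        simp [Xstate, kron2, proj2, vecMulVec_apply, hs]
      all_goals (clear key hρ hu hn hun; grind)
end

section
/- Let ρ be the 4×4 X-state determined by 2×2 matrices a = [[a₁₁, a₁₂],[conj(a₁₂), a₂₂]] and b = [[b₁₁, b₁₂],[conj(b₁₂), b₂₂]], with a₁₁, a₂₂, b₁₁, b₂₂ real, a₁₂ ≠ 0, b₁₂ ≠ 0, and ρ positive semidefinite. Then ρ is classical-quantum if and only if there exist real numbers μ, ν such that b = V·a·V†, where V = [[0, e^{iμ}],[e^{iν}, 0]] (an antidiagonal unitary), i.e. if and only if a and b are unitarily equivalent via an antidiagonal phase unitary. -/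
open Matrix ComplexOrder

theorem cq_complete (f g : Fin 2 → ℂ) (h1 : star f ⬝ᵥ f = 1) (h2 : star g ⬝ᵥ g = 1)
    (h3 : star f ⬝ᵥ g = 0) :
    f 0 * star (f 0) + g 0 * star (g 0) = 1 ∧ f 1 * star (f 1) + g 1 * star (g 1) = 1 ∧
    f 0 * star (f 1) + g 0 * star (g 1) = 0 ∧ f 1 * star (f 0) + g 1 * star (g 0) = 0 := by
  have h4 : star g ⬝ᵥ f = 0 := by
    have := congrArg star h3
    simp only [dotProduct, Fin.sum_univ_two, Pi.star_apply, star_add, star_mul', star_star,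
      star_zero] at this ⊢
    linear_combination this
  simp only [dotProduct, Fin.sum_univ_two, Pi.star_apply] at h1 h2 h3 h4
  have hU : (!![f 0, g 0; f 1, g 1] : Matrix (Fin 2) (Fin 2) ℂ)ᴴ * !![f 0, g 0; f 1, g 1] = 1 := by
    ext i j
    fin_cases i <;> fin_cases j <;>
      simp [Matrix.mul_apply, Fin.sum_univ_two] <;> simpa using (by assumption)
  have hV := mul_eq_one_comm.mp hU
  have e (i j) := congrFun (congrFun hV i) j
  have e00 := e 0 0
  have e01 := e 0 1
  have e10 := e 1 0
  have e11 := e 1 1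
  simp [Matrix.mul_apply, Fin.sum_univ_two] at e00 e01 e10 e11
  exact ⟨e00, e11, e01, e10⟩

theorem cq_psd (f : Fin 2 → ℂ) (ρ : Matrix (Fin 2 ⊕ Fin 2) (Fin 2 ⊕ Fin 2) ℂ)
    (h : ρ.PosSemidef) :
    (star (f 0) • f 0 • ρ.toBlocks₁₁ + star (f 0) • f 1 • ρ.toBlocks₁₂ +
     star (f 1) • f 0 • ρ.toBlocks₂₁ + star (f 1) • f 1 • ρ.toBlocks₂₂).PosSemidef := by
  have := h.conjTranspose_mul_mul_same
    (fromRows (f 0 • (1 : Matrix (Fin 2) (Fin 2) ℂ)) (f 1 • 1))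
  convert this using 1
  ext i j
  fin_cases i <;> fin_cases j <;>
    simp [Matrix.mul_apply, Fin.sum_univ_two, toBlocks₁₁, toBlocks₁₂, toBlocks₂₁, toBlocks₂₂,
      Matrix.one_apply] <;> ring

/-- A positive semidefinite Hermitian X-state with `a₁₂ ≠ 0` and `b₁₂ ≠ 0` is
classical–quantum iff `b = V·a·Vᴴ` for an antidiagonal phase unitary
`V = [[0, e^{iμ}],[e^{iν}, 0]]`. -/
theorem xstate_isCQ_iff_antidiagonal_equiv (a₁₁ a₂₂ b₁₁ b₂₂ : ℝ) (a₁₂ b₁₂ : ℂ)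
    (ha : a₁₂ ≠ 0) (hb : b₁₂ ≠ 0)
    (hρ : (Xstate !![(a₁₁ : ℂ), a₁₂; (starRingEnd ℂ) a₁₂, (a₂₂ : ℂ)]
                  !![(b₁₁ : ℂ), b₁₂; (starRingEnd ℂ) b₁₂, (b₂₂ : ℂ)]).PosSemidef) :
    IsCQ (Xstate !![(a₁₁ : ℂ), a₁₂; (starRingEnd ℂ) a₁₂, (a₂₂ : ℂ)]
                 !![(b₁₁ : ℂ), b₁₂; (starRingEnd ℂ) b₁₂, (b₂₂ : ℂ)]) ↔
      ∃ μ ν : ℝ,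
        !![(b₁₁ : ℂ), b₁₂; (starRingEnd ℂ) b₁₂, (b₂₂ : ℂ)] =
          !![0, Complex.exp (μ * Complex.I); Complex.exp (ν * Complex.I), 0] *
          !![(a₁₁ : ℂ), a₁₂; (starRingEnd ℂ) a₁₂, (a₂₂ : ℂ)] *
          !![0, Complex.exp (μ * Complex.I); Complex.exp (ν * Complex.I), 0]ᴴ := by
  constructor
  · rintro ⟨f, g, σ, τ, h1, h2, h3, hσ, hτ, h⟩
    obtain ⟨c00, c11, c01, c10⟩ := cq_complete f g h1 h2 h3
    have e (i j) := congrFun (congrFun h i) j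
    have k1 := e (.inl 0) (.inl 0)
    have k2 := e (.inl 1) (.inl 1)
    have k3 := e (.inr 0) (.inr 0)
    have k4 := e (.inr 1) (.inr 1)
    have k5 := e (.inl 0) (.inr 0)
    have k6 := e (.inl 1) (.inr 1)
    have k7 := e (.inl 0) (.inr 1)
    have k8 := e (.inl 1) (.inr 0)
    have s1 := hσ.1.apply 0 1
    have t1 := hτ.1.apply 0 1
    clear e h h1 h2 h3
    simp [Xstate, kron2, proj2, vecMulVec_apply] at k1 k2 k3 k4 k5 k6 k7 k8 c00 c11 c01 c10 s1 t1
    set p := f 0 * (starRingEnd ℂ) (f 1) with hp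
    have hq : g 0 * (starRingEnd ℂ) (g 1) = -p := by linear_combination c01
    rw [hq] at k5 k6 k7 k8
    have hp0 : p ≠ 0 := by
      intro h0
      apply ha
      rw [k7, h0]; ring
    have d0 : σ 0 0 = τ 0 0 := by
      apply mul_left_cancel₀ hp0
      linear_combination -k5
    have d1 : σ 1 1 = τ 1 1 := by
      apply mul_left_cancel₀ hp0
      linear_combination -k6
    have r1 : (a₁₁ : ℂ) = b₂₂ := by
      rw [k1, k3, d0]; linear_combination τ 0 0 * (c00 - c11)
    have r2 : (b₁₁ : ℂ) = a₂₂ := by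
      rw [k2, k4, d1]; linear_combination τ 1 1 * (c00 - c11)
    have hn : ‖b₁₂‖ = ‖a₁₂‖ := by
      have x1 : a₁₂ = p * (σ 0 1 - τ 0 1) := by rw [k7]; ring
      have x2 : b₁₂ = p * (starRingEnd ℂ) (σ 0 1 - τ 0 1) := by
        rw [k8, map_sub, ← s1, ← t1]; simp; ring
      rw [x1, x2, norm_mul p, norm_mul p, Complex.norm_conj]
    have ha' : (starRingEnd ℂ) a₁₂ ≠ 0 := by simpa using ha
    have hu : ‖b₁₂ / (starRingEnd ℂ) a₁₂‖ = 1 := by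
      rw [norm_div, Complex.norm_conj, hn, div_self (by simpa using ha)]
    obtain ⟨μ, hμ⟩ := (Complex.norm_eq_one_iff _).mp hu
    rw [eq_div_iff ha'] at hμ
    have hE : Complex.exp (μ * Complex.I) * (starRingEnd ℂ) (Complex.exp (μ * Complex.I)) = 1 := by
      rw [Complex.mul_conj, Complex.normSq_eq_norm_sq, Complex.norm_exp_ofReal_mul_I]; simp
    refine ⟨μ, 0, ?_⟩
    have hμ' := congrArg (starRingEnd ℂ) hμ
    rw [map_mul, Complex.conj_conj] at hμ'
    generalize Complex.exp (μ * Complex.I) = E at *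
    ext i j
    fin_cases i <;> fin_cases j <;>
      simp [Matrix.mul_apply, Fin.sum_univ_two]
    · linear_combination r2 - a₂₂ * hE
    · linear_combination -hμ
    · linear_combination -hμ'
    · exact_mod_cast r1.symm
  · rintro ⟨μ, ν, h⟩
    have e (i j) := congrFun (congrFun h i) j
    have k1 := e 0 0
    have k2 := e 0 1
    have k4 := e 1 1
    clear e h
    have hE (x : ℝ) : Complex.exp (x * Complex.I) * (starRingEnd ℂ) (Complex.exp (x * Complex.I)) = 1 := by
      rw [Complex.mul_conj, Complex.normSq_eq_norm_sq, Complex.norm_exp_ofReal_mul_I]; simp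
    obtain ⟨w, hw, hwb⟩ : ∃ w : ℂ, w * (starRingEnd ℂ) w = 1 ∧
        b₁₂ = w * w * (starRingEnd ℂ) a₁₂ := by
      refine ⟨Complex.exp (((μ - ν) / 2 : ℝ) * Complex.I), hE _, ?_⟩
      have : (starRingEnd ℂ) (Complex.exp (ν * Complex.I)) = Complex.exp (-(ν * Complex.I)) := by
        rw [← Complex.exp_conj]; simp
      rw [← Complex.exp_add]
      simp [Matrix.mul_apply, Fin.sum_univ_two] at k2
      rw [k2, this, mul_right_comm, ← Complex.exp_add]
      congr 2
      push_cast; ring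
    have r1 : (b₁₁ : ℂ) = a₂₂ := by
      simp [Matrix.mul_apply, Fin.sum_univ_two] at k1
      rw [k1]; linear_combination a₂₂ * hE μ
    have r2 : (b₂₂ : ℂ) = a₁₁ := by
      simp [Matrix.mul_apply, Fin.sum_univ_two] at k4
      rw [k4]; linear_combination a₁₁ * hE ν
    clear k1 k2 k4
    obtain ⟨c, hc, hcc⟩ : ∃ c : ℂ, (starRingEnd ℂ) c = c ∧ c * c = 1 / 2 := by
      refine ⟨((√(1/2) : ℝ) : ℂ), Complex.conj_ofReal _, ?_⟩
      rw [← Complex.ofReal_mul, Real.mul_self_sqrt (by norm_num)]; simp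
    have hwb' : (starRingEnd ℂ) b₁₂ = (starRingEnd ℂ) w * (starRingEnd ℂ) w * a₁₂ := by
      rw [hwb]; simp
    have P1 := cq_psd ![c, c * (starRingEnd ℂ) w] _ hρ
    have P2 := cq_psd ![c, -(c * (starRingEnd ℂ) w)] _ hρ
    refine ⟨![c, c * (starRingEnd ℂ) w], ![c, -(c * (starRingEnd ℂ) w)], _, _, ?_, ?_, ?_, P1, P2, ?_⟩
    · simp [dotProduct, Fin.sum_univ_two, hc]
      linear_combination (1 + w * (starRingEnd ℂ) w) * hcc + 1 / 2 * hw
    · simp [dotProduct, Fin.sum_univ_two, hc]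
      linear_combination (1 + w * (starRingEnd ℂ) w) * hcc + 1 / 2 * hw
    · simp [dotProduct, Fin.sum_univ_two, hc]
      linear_combination (- c * c) * hw
    · clear P1 P2 hρ
      rw [r1, r2, hwb', hwb]
      have hv : (starRingEnd ℂ) w = w⁻¹ := eq_inv_of_mul_eq_one_right hw
      have hw0 : w ≠ 0 := left_ne_zero_of_mul_eq_one hw
      have hc4 : c ^ 4 = 1 / 4 := by linear_combination (c * c + 1 / 2) * hcc
      ext i j
      rcases i with i | i <;> rcases j with j | j <;> fin_cases i <;> fin_cases j <;>
        simp [Xstate, kron2, proj2, vecMulVec_apply, hc, hv, toBlocks₁₁, toBlocks₁₂, toBlocks₂₁,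
          toBlocks₂₂] <;> field_simp <;> ring_nf <;> (try rw [hc4]) <;> ring
end

section
/- Let p₁, p₂, p₃, p₄ be nonnegative reals with p₁+p₂+p₃+p₄ = 1, p₁ ≠ p₂ and p₃ ≠ p₄, and let ρ be the Bell-diagonal two-qubit state with a₁₁ = a₂₂ = p₁+p₂, a₁₂ = p₁−p₂, b₁₁ = b₂₂ = p₃+p₄, b₁₂ = p₃−p₄. Then ρ is classical-quantum — there exist an orthonormal basis {f₁, f₂} of ℂ² and positive semidefinite 2×2 matrices σ₁, σ₂ with ρ = |f₁⟩⟨f₁| ⊗ σ₁ + |f₂⟩⟨f₂| ⊗ σ₂ — if and only if either (p₁ = p₃ and p₂ = p₄) or (p₁ = p₄ and p₂ = p₃). -/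
open Matrix ComplexOrder

lemma bd_unitary (f g : Fin 2 → ℂ) (h1 : star f ⬝ᵥ f = 1) (h2 : star g ⬝ᵥ g = 1)
    (h3 : star f ⬝ᵥ g = 0) : proj2 f + proj2 g = 1 := by
  have h4 : star g ⬝ᵥ f = 0 := by
    have := congrArg star h3
    simpa [dotProduct, Fin.sum_univ_two, mul_comm] using this
  have hU : (!![star f 0, star f 1; star g 0, star g 1] : Matrix (Fin 2) (Fin 2) ℂ) *
      !![f 0, g 0; f 1, g 1] = 1 := by
    simp only [dotProduct, Fin.sum_univ_two] at h1 h2 h3 h4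
    rw [Matrix.mul_fin_two, h1, h2, h3, h4, Matrix.one_fin_two]
  have hV := mul_eq_one_comm.mp hU
  rw [← hV, Matrix.mul_fin_two]
  ext i j
  fin_cases i <;> fin_cases j <;> simp [proj2, vecMulVec_apply]

lemma bd_psd (p q : ℝ) (hp : 0 ≤ p) (hq : 0 ≤ q) (u v : Fin 2 → ℂ) :
    ((p : ℂ) • proj2 u + (q : ℂ) • proj2 v).PosSemidef := by
  refine PosSemidef.add ?_ ?_
  · exact (posSemidef_vecMulVec_self_star u).smul (by exact_mod_cast hp)
  · exact (posSemidef_vecMulVec_self_star v).smul (by exact_mod_cast hq)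

lemma bd_back (z c : ℂ) (hz : star z * z = 1) (hc : star c * c = 1) (p q : ℝ)
    (hp : 0 ≤ p) (hq : 0 ≤ q) (M : Matrix (Fin 2 ⊕ Fin 2) (Fin 2 ⊕ Fin 2) ℂ)
    (hM : M = fromBlocks !![(p:ℂ)+q, 0; 0, (p:ℂ)+q]
      !![0, star z * star c * ((p:ℂ)-q); star z * c * ((p:ℂ)-q), 0]
      !![0, z * star c * ((p:ℂ)-q); z * c * ((p:ℂ)-q), 0] !![(p:ℂ)+q, 0; 0, (p:ℂ)+q]) :
    IsCQ M := by
  obtain ⟨r, hr, hr2⟩ : ∃ r : ℂ, star r = r ∧ r * r = 1/2 := by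
    refine ⟨((Real.sqrt (1/2) : ℝ) : ℂ), Complex.conj_ofReal _, ?_⟩
    rw [← Complex.ofReal_mul, Real.mul_self_sqrt (by norm_num)]
    norm_num
  refine ⟨![r, r * z], ![r, -(r * z)], (p:ℂ) • proj2 ![1, c] + (q:ℂ) • proj2 ![1, -c],
    (q:ℂ) • proj2 ![1, c] + (p:ℂ) • proj2 ![1, -c], ?_, ?_, ?_, bd_psd _ _ hp hq _ _,
    bd_psd _ _ hq hp _ _, ?_⟩
  · simp only [dotProduct, Fin.sum_univ_two, Pi.star_apply, cons_val_zero, cons_val_one, star_mul, star_neg, hr]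
    linear_combination (1 + star z * z) * hr2 + 1/2 * hz
  · simp only [dotProduct, Fin.sum_univ_two, Pi.star_apply, cons_val_zero, cons_val_one, star_mul, star_neg, hr]
    linear_combination (1 + star z * z) * hr2 + 1/2 * hz
  · simp only [dotProduct, Fin.sum_univ_two, Pi.star_apply, cons_val_zero, cons_val_one, star_mul, star_neg, hr]
    linear_combination -(r*r) * hz
  · rw [hM]
    ext i j
    rcases i with i | i <;> rcases j with j | j <;> fin_cases i <;> fin_cases j <;>
      simp only [kron2, proj2, Matrix.add_apply, fromBlocks_apply₁₁, fromBlocks_apply₁₂,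
        fromBlocks_apply₂₁, fromBlocks_apply₂₂, Matrix.smul_apply, vecMulVec_apply,
        Pi.star_apply, Fin.zero_eta, Fin.mk_one, Fin.isValue, of_apply, cons_val_zero, cons_val_one, star_mul, star_neg,
        star_one, hr, smul_eq_mul, cons_val', cons_val_fin_one] <;>
      grind

/-- A Bell-diagonal two-qubit state with `p₁ ≠ p₂` and `p₃ ≠ p₄` is
classical–quantum iff `(p₁ = p₃ ∧ p₂ = p₄)` or `(p₁ = p₄ ∧ p₂ = p₃)`. -/
theorem bellDiagonal_isCQ_iff (p₁ p₂ p₃ p₄ : ℝ)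
    (h₁ : 0 ≤ p₁) (h₂ : 0 ≤ p₂) (h₃ : 0 ≤ p₃) (h₄ : 0 ≤ p₄)
    (hsum : p₁ + p₂ + p₃ + p₄ = 1)
    (h12 : p₁ ≠ p₂) (h34 : p₃ ≠ p₄) :
    IsCQ (Xstate !![((p₁ + p₂ : ℝ) : ℂ), ((p₁ - p₂ : ℝ) : ℂ);
                    ((p₁ - p₂ : ℝ) : ℂ), ((p₁ + p₂ : ℝ) : ℂ)]
                 !![((p₃ + p₄ : ℝ) : ℂ), ((p₃ - p₄ : ℝ) : ℂ);
                    ((p₃ - p₄ : ℝ) : ℂ), ((p₃ + p₄ : ℝ) : ℂ)]) ↔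
      ((p₁ = p₃ ∧ p₂ = p₄) ∨ (p₁ = p₄ ∧ p₂ = p₃)) := by
  constructor
  · rintro ⟨f, g, A, B, hf, hg, hfg, -, -, h⟩
    have hU := bd_unitary f g hf hg hfg
    have u00 := congrFun₂ hU 0 0
    have u01 := congrFun₂ hU 0 1
    have u10 := congrFun₂ hU 1 0
    have u11 := congrFun₂ hU 1 1
    have e1 := congrFun₂ h (.inl 0) (.inl 0)
    have e2 := congrFun₂ h (.inr 0) (.inr 0)
    have e3 := congrFun₂ h (.inl 0) (.inr 0)
    have e4 := congrFun₂ h (.inl 0) (.inr 1)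
    have e5 := congrFun₂ h (.inl 1) (.inr 0)
    have e6 := congrFun₂ h (.inr 0) (.inl 1)
    have e7 := congrFun₂ h (.inr 1) (.inl 0)
    generalize proj2 f = F at *
    generalize proj2 g = G at *
    simp only [Xstate, kron2, Matrix.add_apply, fromBlocks_apply₁₁, fromBlocks_apply₁₂,
        fromBlocks_apply₂₁, fromBlocks_apply₂₂, Matrix.smul_apply, Fin.isValue, of_apply,
        cons_val_zero, cons_val_one, smul_eq_mul, cons_val', cons_val_fin_one] at e1 e2 e3 e4 e5 e6 e7
    simp at u00 u01 u10 u11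
    have hd : ((p₁ - p₂ : ℝ) : ℂ) ≠ 0 := by exact_mod_cast sub_ne_zero.mpr h12
    have v01 : G 0 1 = - F 0 1 := by linear_combination u01
    have v10 : G 1 0 = - F 1 0 := by linear_combination u10
    have v00 : G 0 0 = 1 - F 0 0 := by linear_combination u00
    have v11 : G 1 1 = 1 - F 1 1 := by linear_combination u11
    rw [v01] at e3 e4 e5
    rw [v10] at e6 e7
    rw [v00] at e1
    rw [v11] at e2
    have hF : F 0 1 ≠ 0 := by
      intro h0
      apply hd
      rw [e4, h0]; ring
    have hD : A 0 0 - B 0 0 = 0 := by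
      have : F 0 1 * (A 0 0 - B 0 0) = 0 := by linear_combination -e3
      exact (mul_eq_zero.mp this).resolve_left hF
    have hst : ((p₁ + p₂ : ℝ) : ℂ) = ((p₃ + p₄ : ℝ) : ℂ) := by
      linear_combination e1 - e2 + (F 0 0 - F 1 1) * hD
    have hde : ((p₁ - p₂ : ℝ) : ℂ) * ((p₁ - p₂ : ℝ) : ℂ)
        = ((p₃ - p₄ : ℝ) : ℂ) * ((p₃ - p₄ : ℝ) : ℂ) := by
      nth_rewrite 1 [e4]
      rw [e7]
      nth_rewrite 1 [e5]
      rw [e6]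
      ring
    have hst' : p₁ + p₂ = p₃ + p₄ := by exact_mod_cast hst
    have hde' : (p₁ - p₂) * (p₁ - p₂) = (p₃ - p₄) * (p₃ - p₄) := by exact_mod_cast hde
    rcases mul_self_eq_mul_self_iff.mp hde' with h | h
    · left; constructor <;> linarith
    · right; constructor <;> linarith
  · rintro (⟨rfl, rfl⟩ | ⟨rfl, rfl⟩)
    · refine bd_back 1 1 (by simp) (by simp) p₁ p₂ h₁ h₂ _ ?_
      simp [Xstate]
    · refine bd_back Complex.I (-Complex.I) (by simp) (by simp) p₁ p₂ h₁ h₂ _ ?_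
      simp [Xstate, add_comm]
end

section
/- For every real q with −1 ≤ q ≤ 1, the 4×4 matrix ρ = (1/4)·[[1,0,0,q],[0,1,±q,0],[0,±q,1,0],[q,0,0,1]] (with either choice of sign in the middle block) is classical-quantum: there exist an orthonormal basis {f₁, f₂} of ℂ² and positive semidefinite 2×2 matrices σ₁, σ₂ such that ρ = |f₁⟩⟨f₁| ⊗ σ₁ + |f₂⟩⟨f₂| ⊗ σ₂. In particular, the equal mixture ½(P_i + P_j) of any two distinct Bell projectors P_i, P_j has vanishing quantum discord. -/
open Matrix ComplexOrder

/-- The four Bell vectors in `ℂ² ⊗ ℂ² ≅ ℂ⁴`, with the product basis ordered as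
`(inl 0, inl 1, inr 0, inr 1) = (e₁⊗e₁, e₁⊗e₂, e₂⊗e₁, e₂⊗e₂)`. -/
noncomputable def bell : Fin 4 → (Fin 2 ⊕ Fin 2 → ℂ) :=
  ![Sum.elim ![((Real.sqrt 2)⁻¹ : ℝ), 0] ![0, ((Real.sqrt 2)⁻¹ : ℝ)],
    Sum.elim ![((Real.sqrt 2)⁻¹ : ℝ), 0] ![0, -((Real.sqrt 2)⁻¹ : ℝ)],
    Sum.elim ![0, ((Real.sqrt 2)⁻¹ : ℝ)] ![((Real.sqrt 2)⁻¹ : ℝ), 0],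
    Sum.elim ![0, ((Real.sqrt 2)⁻¹ : ℝ)] ![-((Real.sqrt 2)⁻¹ : ℝ), 0]]

/-- The rank-one Bell projectors `P_k = |ψ_k⟩⟨ψ_k|`. -/
noncomputable def bellProj (k : Fin 4) : Matrix (Fin 2 ⊕ Fin 2) (Fin 2 ⊕ Fin 2) ℂ :=
  vecMulVec (bell k) (star (bell k))

theorem isCQ_aux (f₁ f₂ : Fin 2 → ℂ) (a b c d : ℝ) (ha : 0 ≤ a) (hb : 0 ≤ b) (hc : 0 ≤ c)
    (hd : 0 ≤ d) (ρ : Matrix (Fin 2 ⊕ Fin 2) (Fin 2 ⊕ Fin 2) ℂ)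
    (h1 : star f₁ ⬝ᵥ f₁ = 1) (h2 : star f₂ ⬝ᵥ f₂ = 1) (h3 : star f₁ ⬝ᵥ f₂ = 0)
    (h : ρ = kron2 (proj2 f₁) ((a : ℂ) • proj2 f₁ + (b : ℂ) • proj2 f₂) +
      kron2 (proj2 f₂) ((c : ℂ) • proj2 f₁ + (d : ℂ) • proj2 f₂)) : IsCQ ρ := by
  have key : ∀ (a b : ℝ), 0 ≤ a → 0 ≤ b →
      ((a : ℂ) • proj2 f₁ + (b : ℂ) • proj2 f₂).PosSemidef := by
    intro a b ha hb
    exact ((posSemidef_vecMulVec_self_star f₁).smul (by exact_mod_cast ha)).add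
      ((posSemidef_vecMulVec_self_star f₂).smul (by exact_mod_cast hb))
  exact ⟨f₁, f₂, _, _, h1, h2, h3, key a b ha hb, key c d hc hd, h⟩

theorem proj2_apply (f : Fin 2 → ℂ) (i j : Fin 2) : proj2 f i j = f i * star (f j) := rfl

theorem sq_aux : (((Real.sqrt 2)⁻¹ : ℝ) : ℂ) * (((Real.sqrt 2)⁻¹ : ℝ) : ℂ) = 1 / 2 := by
  rw [← Complex.ofReal_mul, ← mul_inv, Real.mul_self_sqrt (by norm_num)]
  norm_num

theorem part1 (q : ℝ) (h1 : -1 ≤ q) (h2 : q ≤ 1) (ε : ℝ) (hε : ε = 1 ∨ ε = -1) :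
      IsCQ ((1 / 4 : ℂ) •
        Xstate !![1, (q : ℂ); (q : ℂ), 1]
               !![1, ((ε * q : ℝ) : ℂ); ((ε * q : ℝ) : ℂ), 1]) := by
  have hs := sq_aux
  generalize hr : (Real.sqrt 2)⁻¹ = r at hs
  have hI := Complex.I_mul_I
  rcases hε with rfl | rfl
  · refine isCQ_aux ![r, r] ![r, -r] ((1+q)/4) ((1-q)/4) ((1-q)/4) ((1+q)/4) (by linarith)
      (by linarith) (by linarith) (by linarith) _ ?_ ?_ ?_ ?_
    · simp [dotProduct, Fin.sum_univ_two]; grind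
    · simp [dotProduct, Fin.sum_univ_two]; grind
    · simp [dotProduct, Fin.sum_univ_two]
    · ext i j
      rcases i with i | i <;> rcases j with j | j <;> fin_cases i <;> fin_cases j <;>
        simp [Xstate, kron2, proj2_apply, vecMulVec_apply] <;> grind
  · refine isCQ_aux ![r, r * Complex.I] ![r, -(r * Complex.I)] ((1-q)/4) ((1+q)/4) ((1+q)/4)
      ((1-q)/4) (by linarith) (by linarith) (by linarith) (by linarith) _ ?_ ?_ ?_ ?_
    · simp [dotProduct, Fin.sum_univ_two]; grind
    · simp [dotProduct, Fin.sum_univ_two]; grind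
    · simp [dotProduct, Fin.sum_univ_two]; grind
    · ext i j
      rcases i with i | i <;> rcases j with j | j <;> fin_cases i <;> fin_cases j <;>
        simp [Xstate, kron2, proj2_apply, vecMulVec_apply] <;> grind

theorem mix_aux (q ε : ℝ) (hq : -1 ≤ q) (hq' : q ≤ 1) (hε : ε = 1 ∨ ε = -1)
    (ρ : Matrix (Fin 2 ⊕ Fin 2) (Fin 2 ⊕ Fin 2) ℂ)
    (h : ρ = ((1 / 4 : ℂ) •
        Xstate !![1, (q : ℂ); (q : ℂ), 1]
               !![1, ((ε * q : ℝ) : ℂ); ((ε * q : ℝ) : ℂ), 1])) : IsCQ ρ :=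
  h ▸ part1 q hq hq' ε hε

theorem part2 (i j : Fin 4) (hij : i < j) : IsCQ ((1 / 2 : ℂ) • (bellProj i + bellProj j)) := by
  have hs := sq_aux
  have main : (i = 0 ∧ j = 1) ∨ (i = 2 ∧ j = 3) ∨ (i = 0 ∧ j = 2) ∨ (i = 0 ∧ j = 3) ∨
    (i = 1 ∧ j = 2) ∨ (i = 1 ∧ j = 3) := by revert i j; decide
  rcases main with h | h | h | h | h | h <;> obtain ⟨rfl, rfl⟩ := h
  · refine isCQ_aux ![1, 0] ![0, 1] (1/2) 0 0 (1/2) (by norm_num)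
      (by norm_num) (by norm_num) (by norm_num) _ (by simp [vecHead, vecTail]) (by simp [vecHead, vecTail])
      (by simp [vecHead, vecTail]) ?_
    unfold bellProj bell
    generalize (Real.sqrt 2)⁻¹ = r at hs ⊢
    ext i j
    rcases i with i | i <;> rcases j with j | j <;> fin_cases i <;> fin_cases j <;>
        simp [kron2, proj2_apply, vecMulVec_apply] <;> grind
  · refine isCQ_aux ![1, 0] ![0, 1] 0 (1/2) (1/2) 0 (by norm_num)
      (by norm_num) (by norm_num) (by norm_num) _ (by simp [vecHead, vecTail]) (by simp [vecHead, vecTail])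
      (by simp [vecHead, vecTail]) ?_
    unfold bellProj bell
    generalize (Real.sqrt 2)⁻¹ = r at hs ⊢
    ext i j
    rcases i with i | i <;> rcases j with j | j <;> fin_cases i <;> fin_cases j <;>
        simp [kron2, proj2_apply, vecMulVec_apply] <;> grind
  · refine mix_aux 1 1 (by norm_num) (by norm_num) (by norm_num) _ ?_
    unfold bellProj bell
    generalize (Real.sqrt 2)⁻¹ = r at hs ⊢
    ext i j
    rcases i with i | i <;> rcases j with j | j <;> fin_cases i <;> fin_cases j <;>
        simp [Xstate, vecMulVec_apply] <;> grind
  · refine mix_aux 1 (-1) (by norm_num) (by norm_num) (by norm_num) _ ?_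
    unfold bellProj bell
    generalize (Real.sqrt 2)⁻¹ = r at hs ⊢
    ext i j
    rcases i with i | i <;> rcases j with j | j <;> fin_cases i <;> fin_cases j <;>
        simp [Xstate, vecMulVec_apply] <;> grind
  · refine mix_aux (-1) (-1) (by norm_num) (by norm_num) (by norm_num) _ ?_
    unfold bellProj bell
    generalize (Real.sqrt 2)⁻¹ = r at hs ⊢
    ext i j
    rcases i with i | i <;> rcases j with j | j <;> fin_cases i <;> fin_cases j <;>
        simp [Xstate, vecMulVec_apply] <;> grind
  · refine mix_aux (-1) 1 (by norm_num) (by norm_num) (by norm_num) _ ?_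
    unfold bellProj bell
    generalize (Real.sqrt 2)⁻¹ = r at hs ⊢
    ext i j
    rcases i with i | i <;> rcases j with j | j <;> fin_cases i <;> fin_cases j <;>
        simp [Xstate, vecMulVec_apply] <;> grind

/-- For every `−1 ≤ q ≤ 1` and either sign, the state
`(1/4)·[[1,0,0,q],[0,1,±q,0],[0,±q,1,0],[q,0,0,1]]` is classical–quantum; in
particular the equal mixture of any two distinct Bell projectors has vanishing
quantum discord. -/
theorem bell_mixture_isCQ :
    (∀ q : ℝ, -1 ≤ q → q ≤ 1 → ∀ ε : ℝ, ε = 1 ∨ ε = -1 →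
      IsCQ ((1 / 4 : ℂ) •
        Xstate !![1, (q : ℂ); (q : ℂ), 1]
               !![1, ((ε * q : ℝ) : ℂ); ((ε * q : ℝ) : ℂ), 1])) ∧
    (∀ i j : Fin 4, i ≠ j →
      IsCQ ((1 / 2 : ℂ) • (bellProj i + bellProj j))) := by
  refine ⟨part1, fun i j hij => ?_⟩
  rcases lt_or_gt_of_ne hij with h | h
  · exact part2 i j h
  · rw [add_comm]
    exact part2 j i h
end

section
/- There exists a positive semidefinite 4×4 complex matrix ρ of unit trace that is PPT (its partial transpose, obtained by swapping the off-diagonal 2×2 blocks, is positive semidefinite) but is not SPPT: for all 2×2 complex matrices X₁, X₂, S with S normal, ρ ≠ X†X where X = fromBlocks X₁ (S·X₁) 0 X₂. (For instance, an X-state satisfying a₁₁a₂₂ ≥ |b₁₂|² and b₁₁b₂₂ ≥ |a₁₂|² with |a₁₂| ≠ |b₁₂| and a₁₂, b₁₂ ≠ 0.) Hence the inclusion SPPT ⊂ PPT is proper for two-qubit states. -/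
open Matrix ComplexOrder

/-- The partial transpose with respect to the first factor: viewing a `4 × 4`
matrix as a `2 × 2` block matrix with `2 × 2` blocks, swap the off-diagonal blocks. -/
noncomputable def partialTransposeA
    (ρ : Matrix (Fin 2 ⊕ Fin 2) (Fin 2 ⊕ Fin 2) ℂ) :
    Matrix (Fin 2 ⊕ Fin 2) (Fin 2 ⊕ Fin 2) ℂ :=
  fromBlocks ρ.toBlocks₁₁ ρ.toBlocks₂₁ ρ.toBlocks₁₂ ρ.toBlocks₂₂

/-- A `4 × 4` state, viewed as a `2 × 2` block matrix with `2 × 2` blocks, is SPPT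
if `ρ = XᴴX` with `X = fromBlocks X₁ (S·X₁) 0 X₂` for some normal `S`. -/
def IsSPPT (ρ : Matrix (Fin 2 ⊕ Fin 2) (Fin 2 ⊕ Fin 2) ℂ) : Prop :=
  ∃ X₁ X₂ S : Matrix (Fin 2) (Fin 2) ℂ,
    Sᴴ * S = S * Sᴴ ∧
    ρ = (fromBlocks X₁ (S * X₁) 0 X₂)ᴴ * fromBlocks X₁ (S * X₁) 0 X₂

/-- There is a two-qubit state that is PPT but not SPPT: the inclusion
`SPPT ⊂ PPT` is proper. -/
theorem exists_ppt_not_sppt :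
    ∃ ρ : Matrix (Fin 2 ⊕ Fin 2) (Fin 2 ⊕ Fin 2) ℂ,
      ρ.PosSemidef ∧ ρ.trace = 1 ∧ (partialTransposeA ρ).PosSemidef ∧ ¬ IsSPPT ρ := by
  have hc : (starRingEnd ℂ) 2 = 2 := Complex.conj_ofNat 2
  refine ⟨fromBlocks ((1/4 : ℂ) • 1) ((1/4 : ℂ) • !![0,1;0,0]) ((1/4 : ℂ) • !![0,0;1,0])
    ((1/4 : ℂ) • 1), ?_, ?_, ?_, ?_⟩
  · have h : fromBlocks ((1/4 : ℂ) • 1) ((1/4 : ℂ) • !![0,1;0,0]) ((1/4 : ℂ) • !![0,0;1,0])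
        ((1/4 : ℂ) • 1) = (fromBlocks ((1/2 : ℂ) • 1) ((1/2 : ℂ) • !![0,1;0,0]) 0
          ((1/2 : ℂ) • !![1,0;0,0]))ᴴ * (fromBlocks ((1/2 : ℂ) • 1) ((1/2 : ℂ) • !![0,1;0,0]) 0
          ((1/2 : ℂ) • !![1,0;0,0]) : Matrix (Fin 2 ⊕ Fin 2) (Fin 2 ⊕ Fin 2) ℂ) := by
      rw [fromBlocks_conjTranspose, fromBlocks_multiply]
      congr 1 <;> ext i j <;> fin_cases i <;> fin_cases j <;>
        simp [Matrix.mul_apply, Fin.sum_univ_two, hc] <;> norm_num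
    rw [h]
    exact posSemidef_conjTranspose_mul_self _
  · simp [Matrix.trace, Fin.sum_univ_two]
    norm_num
  · have h : partialTransposeA (fromBlocks ((1/4 : ℂ) • 1) ((1/4 : ℂ) • !![0,1;0,0])
        ((1/4 : ℂ) • !![0,0;1,0]) ((1/4 : ℂ) • 1))
        = (fromBlocks ((1/2 : ℂ) • 1) ((1/2 : ℂ) • !![0,0;1,0]) 0
          ((1/2 : ℂ) • !![0,0;0,1]))ᴴ * (fromBlocks ((1/2 : ℂ) • 1) ((1/2 : ℂ) • !![0,0;1,0]) 0
          ((1/2 : ℂ) • !![0,0;0,1]) : Matrix (Fin 2 ⊕ Fin 2) (Fin 2 ⊕ Fin 2) ℂ) := by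
      rw [partialTransposeA, fromBlocks_conjTranspose, fromBlocks_multiply]
      simp only [toBlocks_fromBlocks₁₁, toBlocks_fromBlocks₁₂, toBlocks_fromBlocks₂₁,
        toBlocks_fromBlocks₂₂]
      congr 1 <;> ext i j <;> fin_cases i <;> fin_cases j <;>
        simp [Matrix.mul_apply, Fin.sum_univ_two, hc] <;> norm_num
    rw [h]
    exact posSemidef_conjTranspose_mul_self _
  · rintro ⟨X, Y, S, hS, h⟩
    rw [fromBlocks_conjTranspose, fromBlocks_multiply, fromBlocks_inj] at h
    obtain ⟨h1, h2, -, -⟩ := h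
    simp only [conjTranspose_zero, zero_mul, add_zero] at h1 h2
    have h3 : ((4 : ℂ) • Xᴴ) * X = 1 := by
      rw [smul_mul_assoc, ← h1, smul_smul]; norm_num
    have h4 : X * Xᴴ = (1/4 : ℂ) • 1 := by
      have h5 := mul_eq_one_comm.mp h3
      rw [mul_smul_comm] at h5
      rw [← h5, smul_smul]; norm_num
    generalize hB : ((1/4 : ℂ) • !![0,1;0,0] : Matrix (Fin 2) (Fin 2) ℂ) = B at h2
    have e1 : Bᴴ * B = (1/4 : ℂ) • (Xᴴ * (Sᴴ * S) * X) := by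
      calc Bᴴ * B = Xᴴ * Sᴴ * (X * Xᴴ) * S * X := by
            rw [h2]; simp only [conjTranspose_mul, conjTranspose_conjTranspose, mul_assoc]
        _ = _ := by rw [h4]; simp [mul_assoc]
    have e2 : B * Bᴴ = (1/4 : ℂ) • (Xᴴ * (S * Sᴴ) * X) := by
      calc B * Bᴴ = Xᴴ * S * (X * Xᴴ) * Sᴴ * X := by
            rw [h2]; simp only [conjTranspose_mul, conjTranspose_conjTranspose, mul_assoc]
        _ = _ := by rw [h4]; simp [mul_assoc]
    have e3 : Bᴴ * B = B * Bᴴ := by rw [e1, e2, hS]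
    have e4 := congrFun (congrFun e3 0) 0
    rw [← hB] at e4
    simp [Matrix.mul_apply, Fin.sum_univ_two] at e4
end

section
/- There exists a positive semidefinite 4×4 complex matrix ρ of unit trace that is SPPT — i.e. ρ = X†X for some 2×2 matrices X₁, X₂, S with S normal and X = fromBlocks X₁ (S·X₁) 0 X₂ — but is not classical-quantum: there do not exist an orthonormal basis {f₁, f₂} of ℂ² and positive semidefinite 2×2 matrices σ₁, σ₂ with ρ = |f₁⟩⟨f₁| ⊗ σ₁ + |f₂⟩⟨f₂| ⊗ σ₂. (For instance, an X-state with |a₁₂| = |b₁₂| ≠ 0 but a₁₁ ≠ b₂₂.) Hence the inclusion {zero discord} ⊂ SPPT is proper for two-qubit states. -/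
open Matrix ComplexOrder

/-- There is a two-qubit state that is SPPT but not classical–quantum: the
inclusion `{zero discord} ⊂ SPPT` is proper. -/
theorem exists_sppt_not_cq :
    ∃ ρ : Matrix (Fin 2 ⊕ Fin 2) (Fin 2 ⊕ Fin 2) ℂ,
      ρ.PosSemidef ∧ ρ.trace = 1 ∧ IsSPPT ρ ∧ ¬ IsCQ ρ := by
  have c2 : (starRingEnd ℂ) 2 = 2 := map_ofNat _ 2
  have c3 : (starRingEnd ℂ) 3 = 3 := map_ofNat _ 3
  let X₁ : Matrix (Fin 2) (Fin 2) ℂ := !![2/3, 0; 0, 1/3]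
  let S : Matrix (Fin 2) (Fin 2) ℂ := !![1, 0; 0, 0]
  refine ⟨(fromBlocks X₁ (S * X₁) 0 0)ᴴ * fromBlocks X₁ (S * X₁) 0 0,
    posSemidef_conjTranspose_mul_self _, ?_, ⟨X₁, 0, S, ?_, rfl⟩, ?_⟩
  · simp [c2, c3, Matrix.trace, X₁, S, Matrix.mul_apply, Fin.sum_univ_two]
    norm_num
  · ext i j
    fin_cases i <;> fin_cases j <;> simp [S, Matrix.mul_apply, Fin.sum_univ_two]
  · rintro ⟨f, g, σ, τ, -, -, h, -, -, hρ⟩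
    have h2 : star g ⬝ᵥ f = 0 := by
      have := congrArg star h
      simp [dotProduct, Fin.sum_univ_two] at this ⊢
      linear_combination this
    have e := fun i j => congrFun (congrFun hρ i) j
    have m00 := e (.inl 0) (.inl 0)
    have m01 := e (.inl 0) (.inr 0)
    have m11 := e (.inr 0) (.inr 0)
    have n00 := e (.inl 1) (.inl 1)
    have n01 := e (.inl 1) (.inr 1)
    have n11 := e (.inr 1) (.inr 1)
    clear e hρ
    simp [c2, c3, X₁, S, Matrix.mul_apply, Fin.sum_univ_two, kron2, proj2, vecMulVec_apply,
      dotProduct] at h h2 m00 m01 m11 n00 n01 n11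
    have key : (f 0 * (starRingEnd ℂ) (f 0) * σ 0 0 + g 0 * (starRingEnd ℂ) (g 0) * τ 0 0) *
        (f 0 * (starRingEnd ℂ) (f 1) * σ 1 1 + g 0 * (starRingEnd ℂ) (g 1) * τ 1 1) +
        (f 0 * (starRingEnd ℂ) (f 1) * σ 0 0 + g 0 * (starRingEnd ℂ) (g 1) * τ 0 0) *
        (f 1 * (starRingEnd ℂ) (f 1) * σ 1 1 + g 1 * (starRingEnd ℂ) (g 1) * τ 1 1) -
        (f 0 * (starRingEnd ℂ) (f 0) * σ 1 1 + g 0 * (starRingEnd ℂ) (g 0) * τ 1 1) *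
        (f 0 * (starRingEnd ℂ) (f 1) * σ 0 0 + g 0 * (starRingEnd ℂ) (g 1) * τ 0 0) -
        (f 0 * (starRingEnd ℂ) (f 1) * σ 1 1 + g 0 * (starRingEnd ℂ) (g 1) * τ 1 1) *
        (f 1 * (starRingEnd ℂ) (f 1) * σ 0 0 + g 1 * (starRingEnd ℂ) (g 1) * τ 0 0) = 0 := by
      linear_combination (σ 0 0 * τ 1 1 - τ 0 0 * σ 1 1) *
        (f 0 * (starRingEnd ℂ) (g 1) * h - g 0 * (starRingEnd ℂ) (f 1) * h2)
    rw [← m00, ← m01, ← m11, ← n00, ← n01, ← n11] at key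
    norm_num at key
end
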